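/- Let Γ be a finite simple graph with at least two vertices, suppose for every ordered pair (w_0, w_1) of vertices a path γ_{w_0,w_1} in Γ from w_0 to w_1 has been chosen, and for each edge e let M_e denote the number of ordered pairs (w_0,w_1) whose chosen path contains e. Then for every p > 1, h^p(Γ) ≥ |Γ|^{1/p} / max_{w_0,w_1} ( ∑_{e ∈ γ_{w_0,w_1}} M_e^{1/(p−1)} )^{(p−1)/p}, where the maximum is over all ordered pairs of vertices. -/

import Mathlib

open Finset

/-- The `ℓ^p` norm of a function on a finite vertex set:
`‖f‖_p = (∑ v, |f v|^p)^(1/p)`. -/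
noncomputable def lpNorm {V : Type*} [Fintype V] (p : ℝ) (f : V → ℝ) : ℝ :=
  (∑ v, |f v| ^ p) ^ (1 / p)

/-- The `ℓ^p` norm of the gradient of `f` on a finite simple graph:
`‖∇f‖_p = (∑ e ∈ E(Γ), |f x_e - f y_e|^p)^(1/p)`. -/
noncomputable def gradLpNorm {V : Type*} [Fintype V] (G : SimpleGraph V) (p : ℝ)
    (f : V → ℝ) : ℝ :=
  letI := Classical.decEq V
  letI := Classical.decRel G.Adj
  (∑ e ∈ G.edgeFinset,
    Sym2.lift ⟨fun x y => |f x - f y| ^ p, fun x y => by show |f x - f y| ^ p = |f y - f x| ^ p; rw [abs_sub_comm]⟩ e) ^ (1 / p)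

/-- The `L^p`-Poincaré constant
`h^p(Γ) = inf { ‖∇f‖_p / ‖f‖_p : f : V(Γ) → ℝ, ∑ v, f v = 0, f ≢ 0 }`
(equal to `0` by convention when the set is empty, e.g. when `|Γ| ≤ 1`). -/
noncomputable def poincareConst {V : Type*} [Fintype V] (G : SimpleGraph V) (p : ℝ) : ℝ :=
  sInf { c : ℝ | ∃ f : V → ℝ, (∑ v, f v) = 0 ∧ f ≠ 0 ∧ c = gradLpNorm G p f / lpNorm p f }


/-- `M_e`: the number of ordered pairs `(w₀, w₁)` of vertices whose chosen path
`γ w₀ w₁` contains the edge `e`. -/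
noncomputable def pathCount {V : Type*} [Fintype V] (G : SimpleGraph V)
    (γ : ∀ w0 w1 : V, G.Path w0 w1) (e : Sym2 V) : ℕ :=
  Nat.card { w : V × V // e ∈ (γ w.1 w.2).val.edges }

/-- The absolute difference of `f` along an edge. -/
noncomputable def edgeDiff {V : Type*} (f : V → ℝ) : Sym2 V → ℝ :=
  Sym2.lift ⟨fun x y => |f x - f y|, fun x y => abs_sub_comm _ _⟩

theorem edgeDiff_mk {V : Type*} (f : V → ℝ) (x y : V) :
    edgeDiff f s(x, y) = |f x - f y| := rfl

theorem edgeDiff_nonneg {V : Type*} (f : V → ℝ) (e : Sym2 V) : 0 ≤ edgeDiff f e := by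
  induction e using Sym2.ind with
  | _ x y => exact abs_nonneg _

theorem walk_bound {V : Type*} {G : SimpleGraph V} (f : V → ℝ) {u v : V} (w : G.Walk u v) :
    |f u - f v| ≤ (w.edges.map (edgeDiff f)).sum := by
  induction w with
  | nil => simp
  | cons h q ih =>
    simp only [SimpleGraph.Walk.edges_cons, List.map_cons, List.sum_cons, edgeDiff_mk]
    exact (abs_sub_le _ _ _).trans (by gcongr)

theorem gradLpNorm_eq {V : Type*} [Fintype V] (G : SimpleGraph V) [Fintype G.edgeSet] (p : ℝ)
    (f : V → ℝ) : gradLpNorm G p f = (∑ e ∈ G.edgeFinset, edgeDiff f e ^ p) ^ (1 / p) := by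
  unfold gradLpNorm
  congr 1
  refine Finset.sum_congr (by ext; simp) fun e _ => ?_
  induction e using Sym2.ind with
  | _ x y => rfl

theorem jensen_step {V : Type*} [Fintype V] [Nonempty V] (p : ℝ) (hp : 1 < p) (f : V → ℝ)
    (hf : ∑ v, f v = 0) (v : V) :
    (Fintype.card V : ℝ) * |f v| ^ p ≤ ∑ w, |f v - f w| ^ p := by
  have hn : (0 : ℝ) < Fintype.card V := by exact_mod_cast Fintype.card_pos
  have h1 : (Fintype.card V : ℝ) * |f v| ≤ ∑ w, |f v - f w| := by
    have : (Fintype.card V : ℝ) * f v = ∑ w, (f v - f w) := by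
      simp [Finset.sum_sub_distrib, hf]
    calc (Fintype.card V : ℝ) * |f v| = |(Fintype.card V : ℝ) * f v| := by
          rw [abs_mul, abs_of_pos hn]
      _ ≤ _ := by rw [this]; exact Finset.abs_sum_le_sum_abs _ _
  have h2 := Real.rpow_sum_le_const_mul_sum_rpow Finset.univ (fun w => f v - f w) hp.le
  have h3 := (Real.rpow_le_rpow (by positivity) h1 (by linarith : (0:ℝ) ≤ p)).trans h2
  rw [Real.mul_rpow hn.le (abs_nonneg _), Finset.card_univ] at h3
  have h4 : (Fintype.card V : ℝ) ^ p = (Fintype.card V : ℝ) ^ (p - 1) * Fintype.card V := by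
    rw [← Real.rpow_add_one hn.ne']; simp
  rw [h4, mul_assoc] at h3
  exact le_of_mul_le_mul_left h3 (by positivity)

theorem holder_step {ι : Type*} (s : Finset ι) (p : ℝ) (hp : 1 < p) (d M : ι → ℝ)
    (hd : ∀ e ∈ s, 0 ≤ d e) (hM : ∀ e ∈ s, 0 < M e) :
    (∑ e ∈ s, d e) ^ p ≤
      ((∑ e ∈ s, M e ^ (1 / (p - 1))) ^ ((p - 1) / p)) ^ p * ∑ e ∈ s, d e ^ p / M e := by
  have hp0 : 0 < p := by linarith
  have hp1 : p - 1 ≠ 0 := by linarith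
  have hpq : (p / (p - 1)).HolderConjugate p := (Real.HolderConjugate.conjExponent hp).symm
  have h := Real.inner_le_Lp_mul_Lq_of_nonneg s (f := fun e => M e ^ (1 / p))
    (g := fun e => d e / M e ^ (1 / p)) hpq
    (fun e he => Real.rpow_nonneg (hM e he).le _)
    (fun e he => div_nonneg (hd e he) (Real.rpow_nonneg (hM e he).le _))
  have e1 : ∑ e ∈ s, M e ^ (1 / p) * (d e / M e ^ (1 / p)) = ∑ e ∈ s, d e :=
    Finset.sum_congr rfl fun e he => by
      have := Real.rpow_pos_of_pos (hM e he) (1 / p)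
      field_simp
  have e2 : ∑ e ∈ s, (M e ^ (1 / p)) ^ (p / (p - 1)) = ∑ e ∈ s, M e ^ (1 / (p - 1)) :=
    Finset.sum_congr rfl fun e he => by
      rw [← Real.rpow_mul (hM e he).le]
      congr 1
      field_simp
  have e3 : ∑ e ∈ s, (d e / M e ^ (1 / p)) ^ p = ∑ e ∈ s, d e ^ p / M e :=
    Finset.sum_congr rfl fun e he => by
      rw [Real.div_rpow (hd e he) (Real.rpow_nonneg (hM e he).le _),
        ← Real.rpow_mul (hM e he).le, one_div_mul_cancel hp0.ne', Real.rpow_one]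
  rw [e1, e2, e3, one_div_div] at h
  have hA : 0 ≤ ∑ e ∈ s, M e ^ (1 / (p - 1)) :=
    Finset.sum_nonneg fun e he => Real.rpow_nonneg (hM e he).le _
  have hB : 0 ≤ ∑ e ∈ s, d e ^ p / M e :=
    Finset.sum_nonneg fun e he => div_nonneg (Real.rpow_nonneg (hd e he) _) (hM e he).le
  have h' := Real.rpow_le_rpow (Finset.sum_nonneg hd) h hp0.le
  rwa [Real.mul_rpow (Real.rpow_nonneg hA _) (Real.rpow_nonneg hB _), ← Real.rpow_mul hB,
    one_div_mul_cancel hp0.ne', Real.rpow_one] at h'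

theorem double_count {V : Type*} [Fintype V] [DecidableEq V] (G : SimpleGraph V)
    [Fintype G.edgeSet]
    (γ : ∀ w0 w1 : V, G.Path w0 w1) (a : Sym2 V → ℝ) (ha : ∀ e, 0 ≤ a e) :
    ∑ w : V × V, ∑ e ∈ (γ w.1 w.2).val.edges.toFinset, a e / (pathCount G γ e : ℝ)
      ≤ ∑ e ∈ G.edgeFinset, a e := by
  have h1 : ∀ w : V × V, ∑ e ∈ (γ w.1 w.2).val.edges.toFinset, a e / (pathCount G γ e : ℝ)
      = ∑ e ∈ G.edgeFinset,
        if e ∈ (γ w.1 w.2).val.edges then a e / (pathCount G γ e : ℝ) else 0 := by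
    intro w
    rw [← Finset.sum_filter]
    refine Finset.sum_congr ?_ fun _ _ => rfl
    ext e
    simp only [List.mem_toFinset, Finset.mem_filter, SimpleGraph.mem_edgeFinset]
    exact ⟨fun h => ⟨(γ w.1 w.2).val.edges_subset_edgeSet h, h⟩, fun h => h.2⟩
  simp_rw [h1]
  rw [Finset.sum_comm]
  refine Finset.sum_le_sum fun e _ => ?_
  rw [← Finset.sum_filter, Finset.sum_const, nsmul_eq_mul]
  have hc : #{w : V × V | e ∈ (γ w.1 w.2).val.edges} = pathCount G γ e := by
    unfold pathCount
    rw [Nat.card_eq_fintype_card, Fintype.card_subtype]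
  rw [hc]
  by_cases h0 : (pathCount G γ e : ℝ) = 0
  · simp [h0, ha e]
  · rw [mul_div_cancel₀ _ h0]

/-- **path-counting lower bound, case `p > 1`.**
Given chosen paths `γ_{w₀,w₁}` between all ordered pairs of vertices of a finite simple
graph `Γ` with at least two vertices, and `M_e` the number of pairs whose path uses the
edge `e`, for `p > 1`:
`h^p(Γ) ≥ |Γ|^(1/p) / max_{w₀,w₁} (∑_{e ∈ γ_{w₀,w₁}} M_e^(1/(p-1)))^((p-1)/p)`. -/
theorem poincareConst_ge_of_paths {V : Type*} [Fintype V] [DecidableEq V]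
    (G : SimpleGraph V) (hcard : 2 ≤ Fintype.card V)
    (γ : ∀ w0 w1 : V, G.Path w0 w1) (p : ℝ) (hp : 1 < p) :
    (Fintype.card V : ℝ) ^ (1 / p) /
      sSup { x : ℝ | ∃ w0 w1 : V,
        x = (∑ e ∈ (γ w0 w1).val.edges.toFinset,
              (pathCount G γ e : ℝ) ^ (1 / (p - 1))) ^ ((p - 1) / p) }
      ≤ poincareConst G p := by
  classical
  have hp0 : 0 < p := by linarith
  haveI : Nonempty V := Fintype.card_pos_iff.mp (by omega)
  set X := { x : ℝ | ∃ w0 w1 : V,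
        x = (∑ e ∈ (γ w0 w1).val.edges.toFinset,
              (pathCount G γ e : ℝ) ^ (1 / (p - 1))) ^ ((p - 1) / p) } with hX
  have hbdd : BddAbove X := by
    have : X = Set.range (fun w : V × V => (∑ e ∈ (γ w.1 w.2).val.edges.toFinset,
              (pathCount G γ e : ℝ) ^ (1 / (p - 1))) ^ ((p - 1) / p)) := by
      ext x
      simp only [hX, Set.mem_setOf_eq, Set.mem_range, Prod.exists]
      exact ⟨fun ⟨a, b, h⟩ => ⟨a, b, h.symm⟩, fun ⟨a, b, h⟩ => ⟨a, b, h.symm⟩⟩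
    rw [this]
    exact (Set.finite_range _).bddAbove
  have hX0 : 0 ≤ sSup X := by
    apply Real.sSup_nonneg
    rintro x ⟨w0, w1, rfl⟩
    positivity
  set S := sSup X with hS
  unfold poincareConst
  apply le_csInf
  · obtain ⟨a, b, hab⟩ := Fintype.one_lt_card_iff.mp (by omega : 1 < Fintype.card V)
    refine ⟨_, Pi.single a 1 - Pi.single b 1, ?_, ?_, rfl⟩
    · simp [Finset.sum_sub_distrib]
    · intro h
      have := congrFun h a
      simp [hab] at this
  rintro c ⟨f, hf, hf0, rfl⟩
  rw [gradLpNorm_eq]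
  unfold lpNorm
  set A := ∑ v, |f v| ^ p with hA
  set B := ∑ e ∈ G.edgeFinset, edgeDiff f e ^ p with hB
  have hB0 : 0 ≤ B := Finset.sum_nonneg fun e _ => Real.rpow_nonneg (edgeDiff_nonneg f e) _
  have hA0 : 0 < A := by
    obtain ⟨v, hv⟩ := Function.ne_iff.mp hf0
    exact Finset.sum_pos' (fun _ _ => by positivity)
      ⟨v, Finset.mem_univ _, Real.rpow_pos_of_pos (abs_pos.mpr hv) _⟩
  have hpair : ∀ w : V × V, |f w.1 - f w.2| ^ p ≤
      S ^ p * ∑ e ∈ (γ w.1 w.2).val.edges.toFinset, edgeDiff f e ^ p / (pathCount G γ e : ℝ) := by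
    intro w
    have h1 := walk_bound f (γ w.1 w.2).val
    rw [← List.sum_toFinset _ (γ w.1 w.2).2.isTrail.edges_nodup] at h1
    have h2 := holder_step (γ w.1 w.2).val.edges.toFinset p hp (edgeDiff f)
      (fun e => (pathCount G γ e : ℝ)) (fun e _ => edgeDiff_nonneg f e) (fun e he => by
        unfold pathCount
        haveI : Nonempty { w : V × V // e ∈ (γ w.1 w.2).val.edges } :=
          ⟨⟨w, List.mem_toFinset.mp he⟩⟩
        exact_mod_cast Nat.card_pos)
    refine (Real.rpow_le_rpow (abs_nonneg _) h1 hp0.le).trans (h2.trans ?_)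
    refine mul_le_mul_of_nonneg_right (Real.rpow_le_rpow (by positivity)
      (le_csSup hbdd ⟨w.1, w.2, rfl⟩) hp0.le) ?_
    exact Finset.sum_nonneg fun e _ =>
      div_nonneg (Real.rpow_nonneg (edgeDiff_nonneg f e) _) (Nat.cast_nonneg _)
  have hmain : (Fintype.card V : ℝ) * A ≤ S ^ p * B := by
    calc (Fintype.card V : ℝ) * A ≤ ∑ v, ∑ w, |f v - f w| ^ p := by
          rw [hA, Finset.mul_sum]
          exact Finset.sum_le_sum fun v _ => jensen_step p hp f hf v
      _ = ∑ w : V × V, |f w.1 - f w.2| ^ p := by rw [Fintype.sum_prod_type]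
      _ ≤ _ := Finset.sum_le_sum fun w _ => hpair w
      _ ≤ S ^ p * B := by
          rw [← Finset.mul_sum]
          exact mul_le_mul_of_nonneg_left
            (double_count G γ _ fun e => Real.rpow_nonneg (edgeDiff_nonneg f e) _)
            (Real.rpow_nonneg hX0 _)
  have hfin := Real.rpow_le_rpow (by positivity) hmain (by positivity : 0 ≤ 1 / p)
  rw [Real.mul_rpow (by positivity) hA0.le, Real.mul_rpow (by positivity) hB0,
    ← Real.rpow_mul hX0, mul_one_div_cancel hp0.ne', Real.rpow_one] at hfin
  rcases hX0.eq_or_lt with h0 | h0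
  · rw [← h0, div_zero]
    positivity
  · rw [div_le_div_iff₀ h0 (by positivity)]
    linarith
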